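/- arXiv:2312.02838 — 2 statements merged into one kernel-verified Lean document; each statement's English description precedes it below -/
import Mathlib

section
/- Fix p ≥ 1 and q ≥ 0. For a subset S ⊆ {1,…,p−1} and x, y ∈ UT2 define u_k(S) = y and v_k(S) = x if k ∈ S, and u_k(S) = x and v_k(S) = y otherwise. For 0 ≤ i ≤ q define the functions UT2 × UT2 → M2(F): b^{(i)}(x,y) = Σ_{S ⊆ {1,…,p−1}} (−1)^{|S|} · x^{i} · u_1(S)⋯u_{p−1}(S) · (xy − yx) · v_1(S)⋯v_{p−1}(S) · x^{q−i}; c^{(i)}(x,y) = the same sum with middle factor (x·e12·y − y·e12·x); d^{(i)}(x,y) = the same sum with middle factor (x·e22·y − y·e22·x). Then these 3(q+1) functions are linearly independent over F in the space of all functions UT2 × UT2 → M2(F). (This is the key step showing that the multiplicity of χ_{(p+q,p)} in the generalized cocharacter of UT2 is at least 3(q+1); by Theorem 4.4 it equals 3(q+1).) -/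
/-- The standard matrix unit `e₁₂` in the algebra of `2×2` matrices. -/
def e12 (F : Type*) [Field F] : Matrix (Fin 2) (Fin 2) F := !![0, 1; 0, 0]

/-- The standard matrix unit `e₂₂` in the algebra of `2×2` matrices. -/
def e22 (F : Type*) [Field F] : Matrix (Fin 2) (Fin 2) F := !![0, 0; 0, 1]

/-- The `F`-subspace of `2×2` upper triangular matrices inside the full matrix algebra. -/
def UTsub (F : Type*) [Field F] : Submodule F (Matrix (Fin 2) (Fin 2) F) where
  carrier := {m | m 1 0 = 0}
  add_mem' := by
    intro a b ha hb
    simp only [Set.mem_setOf_eq, Matrix.add_apply] at *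
    rw [ha, hb, add_zero]
  zero_mem' := rfl
  smul_mem' := by
    intro c a ha
    simp only [Set.mem_setOf_eq, Matrix.smul_apply] at *
    rw [ha, smul_zero]

/-- The algebra `UT₂` of `2×2` upper triangular matrices, as a type. -/
abbrev UT (F : Type*) [Field F] := ↥(UTsub F)

/-- `uprod m x y S = u₁(S)⋯u_m(S)` where `u_k(S) = y` if `k ∈ S` and `u_k(S) = x` otherwise. -/
def uprod {F : Type*} [Field F] (m : ℕ) (x y : Matrix (Fin 2) (Fin 2) F)
    (S : Finset (Fin m)) : Matrix (Fin 2) (Fin 2) F :=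
  (List.ofFn fun k : Fin m => if k ∈ S then y else x).prod

/-- The alternating sum `Σ_S (−1)^{|S|} · xⁱ · u₁(S)⋯u_{p−1}(S) · w(x,y) · v₁(S)⋯v_{p−1}(S) ·
x^{q−i}` where the middle factor `w(x,y)` is a parameter (`u_k(S) = y, v_k(S) = x` for
`k ∈ S` and `u_k(S) = x, v_k(S) = y` otherwise). -/
def altSum {F : Type*} [Field F] (p q : ℕ)
    (w : Matrix (Fin 2) (Fin 2) F → Matrix (Fin 2) (Fin 2) F → Matrix (Fin 2) (Fin 2) F)
    (i : Fin (q + 1)) (xy : UT F × UT F) : Matrix (Fin 2) (Fin 2) F :=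
  let x : Matrix (Fin 2) (Fin 2) F := ↑xy.1
  let y : Matrix (Fin 2) (Fin 2) F := ↑xy.2
  ∑ S : Finset (Fin (p - 1)),
    ((-1 : F) ^ S.card) •
      (x ^ (i : ℕ) * uprod (p - 1) x y S * w x y * uprod (p - 1) y x S * x ^ (q - (i : ℕ)))

/-- The `3(q+1)` functions `b⁽ⁱ⁾, c⁽ⁱ⁾, d⁽ⁱ⁾ : UT₂ × UT₂ → M₂(F)`, `0 ≤ i ≤ q`, attached to
the two-row partition `(p+q, p)`: alternating sums with middle factors `xy − yx`,
`x·e₁₂·y − y·e₁₂·x` and `x·e₂₂·y − y·e₂₂·x` respectively. -/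
def twoRowFamily (F : Type*) [Field F] (p q : ℕ) :
    (Fin (q + 1) ⊕ Fin (q + 1)) ⊕ Fin (q + 1) → UT F × UT F → Matrix (Fin 2) (Fin 2) F
  | Sum.inl (Sum.inl i) => altSum p q (fun x y => x * y - y * x) i
  | Sum.inl (Sum.inr i) => altSum p q (fun x y => x * e12 F * y - y * e12 F * x) i
  | Sum.inr i => altSum p q (fun x y => x * e22 F * y - y * e22 F * x) i

open Polynomial in
/-- A homogeneous sum vanishing at every nonzero point has zero coefficients. -/
theorem coeff_eq_zero_of_forall_ne_zero {F : Type*} [Field F] [CharZero F] {q : ℕ}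
    (g : Fin (q + 1) → F) (h : ∀ a : F, a ≠ 0 → ∑ i, g i * a ^ (i : ℕ) = 0) (i : Fin (q + 1)) :
    g i = 0 := by
  have hP : (∑ j, C (g j) * X ^ (j : ℕ) : F[X]) = 0 := by
    refine eq_zero_of_infinite_isRoot _ ((Set.finite_singleton (0 : F)).infinite_compl.mono ?_)
    intro a ha
    simpa [IsRoot, eval_finsetSum] using h a ha
  simpa [finsetSum_coeff, coeff_C_mul, coeff_X_pow, Fin.val_inj] using congrArg (coeff · i) hP

/-- Diagonal entries of a product of `2×2` upper triangular matrices. -/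
theorem list_prod_upperTriangular {F : Type*} [Field F] (l : List (Matrix (Fin 2) (Fin 2) F))
    (hl : ∀ M ∈ l, M 1 0 = 0) :
    l.prod 1 0 = 0 ∧ l.prod 0 0 = (l.map fun M => M 0 0).prod ∧
      l.prod 1 1 = (l.map fun M => M 1 1).prod := by
  induction l with
  | nil => simp
  | cons M l ih =>
    obtain ⟨h₁, h₂, h₃⟩ := ih fun N hN => hl N (List.mem_cons_of_mem _ hN)
    have hM := hl M List.mem_cons_self
    simp [Matrix.mul_apply, Fin.sum_univ_two, h₁, h₂, h₃, hM]

theorem pow_upperTriangular {F : Type*} [Field F] {x : Matrix (Fin 2) (Fin 2) F}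
    (hx : x 1 0 = 0) (n : ℕ) :
    (x ^ n) 1 0 = 0 ∧ (x ^ n) 0 0 = x 0 0 ^ n ∧ (x ^ n) 1 1 = x 1 1 ^ n := by
  simpa using list_prod_upperTriangular (List.replicate n x)
    (by simp +contextual [List.mem_replicate, hx])

theorem uprod_upperTriangular {F : Type*} [Field F] {x y : Matrix (Fin 2) (Fin 2) F}
    (hx : x 1 0 = 0) (hy : y 1 0 = 0) (m : ℕ) (S : Finset (Fin m)) :
    uprod m x y S 1 0 = 0 ∧ uprod m x y S 0 0 = y 0 0 ^ S.card * x 0 0 ^ (m - S.card) ∧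
      uprod m x y S 1 1 = y 1 1 ^ S.card * x 1 1 ^ (m - S.card) := by
  have h := list_prod_upperTriangular (List.ofFn fun k : Fin m => if k ∈ S then y else x) (by
    intro M hM
    obtain ⟨k, rfl⟩ := (List.mem_ofFn' _ _).1 hM
    dsimp only
    split_ifs <;> assumption)
  have hc : (Finset.univ.filter fun k => k ∉ S).card = m - S.card := by
    rw [← Finset.compl_filter, Finset.card_compl]
    simp
  have hd (j : Fin 2) : ((List.ofFn fun k : Fin m => if k ∈ S then y else x).map
      fun M => M j j).prod = y j j ^ S.card * x j j ^ (m - S.card) := by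
    rw [List.map_ofFn, List.prod_ofFn]
    simp only [Function.comp_apply, apply_ite (fun M : Matrix (Fin 2) (Fin 2) F => M j j)]
    rw [Finset.prod_ite, Finset.prod_const, Finset.prod_const, hc]
    simp
  exact ⟨h.1, h.2.1.trans (hd 0), h.2.2.trans (hd 1)⟩

/-- If the middle factor is `t • e₁₂`, then the alternating sum is a power of a
`2×2` determinant in the diagonal entries times a monomial. -/
theorem altSum_apply_zero_one {F : Type*} [Field F] (p q : ℕ)
    (w : Matrix (Fin 2) (Fin 2) F → Matrix (Fin 2) (Fin 2) F → Matrix (Fin 2) (Fin 2) F)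
    (i : Fin (q + 1)) (x y : UT F) (t : F) (hw : w x y = !![0, t; 0, 0]) :
    altSum p q w i (x, y) 0 1 =
      x.1 0 0 ^ (i : ℕ) * x.1 1 1 ^ (q - (i : ℕ)) *
        (x.1 0 0 * y.1 1 1 - y.1 0 0 * x.1 1 1) ^ (p - 1) * t := by
  obtain ⟨x, hx⟩ := x
  obtain ⟨y, hy⟩ := y
  replace hx : x 1 0 = 0 := hx
  replace hy : y 1 0 = 0 := hy
  dsimp only at hw ⊢
  have hsum := Fintype.sum_pow_mul_eq_add_pow (Fin (p - 1)) (-(y 0 0 * x 1 1)) (x 0 0 * y 1 1)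
  rw [Fintype.card_fin, neg_add_eq_sub] at hsum
  simp only [altSum, hw, Matrix.sum_apply, ← hsum, Finset.mul_sum, Finset.sum_mul]
  refine Finset.sum_congr rfl fun S _ => ?_
  obtain ⟨hu, hu₀, -⟩ := uprod_upperTriangular hx hy (p - 1) S
  obtain ⟨hv, -, hv₁⟩ := uprod_upperTriangular hy hx (p - 1) S
  obtain ⟨-, hi, -⟩ := pow_upperTriangular hx (i : ℕ)
  obtain ⟨-, -, hj⟩ := pow_upperTriangular hx (q - (i : ℕ))
  simp only [Matrix.smul_apply, Matrix.mul_apply, Fin.sum_univ_two, hu, hu₀, hv, hv₁, hi, hj,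
    smul_eq_mul, Matrix.of_apply, Matrix.cons_val', Matrix.cons_val_zero, Matrix.cons_val_one,
    Matrix.cons_val_fin_one]
  rw [neg_pow]
  ring

/-- The value of a linear combination of the family, up to a nonzero factor, at
`x = !![a, b; 0, 1]`, `y = !![0, e; 0, 1]`. -/
theorem sum_twoRowFamily_apply {F : Type*} [Field F] (p q : ℕ)
    (g : (Fin (q + 1) ⊕ Fin (q + 1)) ⊕ Fin (q + 1) → F) (a b e : F) :
    (∑ k, g k • twoRowFamily F p q k)
        (⟨!![a, b; 0, 1], rfl⟩, ⟨!![0, e; 0, 1], rfl⟩) 0 1 =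
      a ^ (p - 1) *
        ((∑ i, g (.inl (.inl i)) * a ^ (i : ℕ)) * (b + e * (a - 1)) +
          (∑ i, g (.inl (.inr i)) * a ^ (i : ℕ)) * a +
          (∑ i, g (.inr i) * a ^ (i : ℕ)) * (b - e)) := by
  have hb (i : Fin (q + 1)) := altSum_apply_zero_one p q (fun x y => x * y - y * x) i
    ⟨!![a, b; 0, 1], rfl⟩ ⟨!![0, e; 0, 1], rfl⟩ (b + e * (a - 1)) (by
      ext r s; fin_cases r <;> fin_cases s <;> simp <;> ring)
  have hc (i : Fin (q + 1)) := altSum_apply_zero_one p q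
    (fun x y => x * e12 F * y - y * e12 F * x) i
    ⟨!![a, b; 0, 1], rfl⟩ ⟨!![0, e; 0, 1], rfl⟩ a (by
      ext r s; fin_cases r <;> fin_cases s <;> simp [e12])
  have hd (i : Fin (q + 1)) := altSum_apply_zero_one p q
    (fun x y => x * e22 F * y - y * e22 F * x) i
    ⟨!![a, b; 0, 1], rfl⟩ ⟨!![0, e; 0, 1], rfl⟩ (b - e) (by
      ext r s; fin_cases r <;> fin_cases s <;> simp [e22])
  simp only [Fintype.sum_sum_type, twoRowFamily, Finset.sum_apply, Pi.smul_apply,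
    Matrix.sum_apply, Matrix.smul_apply, hb, hc, hd, smul_eq_mul]
  rw [mul_add, mul_add]
  simp only [Finset.sum_mul, Finset.mul_sum]
  refine congrArg₂ _ (congrArg₂ _ ?_ ?_) ?_ <;>
  · refine Finset.sum_congr rfl fun i _ => ?_
    simp
    ring

/-- Fix `p ≥ 1`, `q ≥ 0`. The `3(q+1)` functions `b⁽ⁱ⁾, c⁽ⁱ⁾, d⁽ⁱ⁾`, `0 ≤ i ≤ q`, are
linearly independent over `F`; hence `m_{(p+q,p)} ≥ 3(q+1)` in the generalized
cocharacter of `UT₂`. -/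
theorem two_row_multiplicity_lower_bound (F : Type*) [Field F] [CharZero F]
    (p q : ℕ) (hp : 1 ≤ p) :
    LinearIndependent F (twoRowFamily F p q) := by
  rw [Fintype.linearIndependent_iff]
  intro g hg
  have key (a : F) (ha : a ≠ 0) (b e : F) :
      (∑ i, g (.inl (.inl i)) * a ^ (i : ℕ)) * (b + e * (a - 1)) +
        (∑ i, g (.inl (.inr i)) * a ^ (i : ℕ)) * a +
        (∑ i, g (.inr i) * a ^ (i : ℕ)) * (b - e) = 0 := by
    have h := sum_twoRowFamily_apply p q g a b e
    rw [hg] at h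
    exact (mul_eq_zero.1 h.symm).resolve_left (pow_ne_zero _ ha)
  have hc (a : F) (ha : a ≠ 0) : ∑ i, g (.inl (.inr i)) * a ^ (i : ℕ) = 0 := by
    simpa [ha] using key a ha 0 0
  have hb (a : F) (ha : a ≠ 0) : ∑ i, g (.inl (.inl i)) * a ^ (i : ℕ) = 0 := by
    simpa [ha, hc a ha] using key a ha 1 1
  have hd (a : F) (ha : a ≠ 0) : ∑ i, g (.inr i) * a ^ (i : ℕ) = 0 := by
    simpa [hb a ha, hc a ha] using key a ha 1 0
  rintro ((i | i) | i)
  · exact coeff_eq_zero_of_forall_ne_zero _ hb i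
  · exact coeff_eq_zero_of_forall_ne_zero _ hc i
  · exact coeff_eq_zero_of_forall_ne_zero _ hd i
end

section
/- For every n ≥ 1 the following identity holds in ℚ: Σ_{p=1}^{⌊(n−1)/2⌋} C(n,p+1) · p · (n−2p)^2 / (n−p+1) = (n−4)·2^{n−1} + n + 2. (This computes Σ (q+1)·d_{(p+q,p,1)} over all partitions (p+q,p,1) of n, where d_{(p+q,p,1)} = C(n,p+1)·p·(n−2p)/(n−p+1) is the degree of the irreducible S_n-character χ_{(p+q,p,1)}, q = n − 2p − 1.) -/
/-- A sum weighted by a row of Pascal's triangle, expressed through the previous row. -/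
theorem sum_choose_succ_mul_eq {R : Type*} [CommSemiring R] (f : ℕ → R) (N : ℕ) :
    ∑ k ∈ Finset.range (N + 2), ((N + 1).choose k : R) * f k
      = ∑ k ∈ Finset.range (N + 1), (N.choose k : R) * (f k + f (k + 1)) := by
  have h := Finset.sum_choose_succ_mul (fun k _ => f k) N
  rw [h, add_comm, ← Finset.sum_add_distrib]
  exact Finset.sum_congr rfl fun k _ => by ring

theorem sum_choose_mul_sub_two_mul_sq (N : ℕ) :
    ∑ k ∈ Finset.range (N + 1), (N.choose k : ℚ) * ((N : ℚ) - 2 * k) ^ 2 = (N : ℚ) * 2 ^ N := by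
  induction N with
  | zero => simp
  | succ N ih =>
    have h0 : ∑ k ∈ Finset.range (N + 1), (N.choose k : ℚ) = 2 ^ N := by
      exact_mod_cast Nat.sum_range_choose N
    rw [sum_choose_succ_mul_eq]
    calc _ = ∑ k ∈ Finset.range (N + 1),
          (2 * ((N.choose k : ℚ) * ((N : ℚ) - 2 * k) ^ 2) + 2 * (N.choose k : ℚ)) :=
          Finset.sum_congr rfl fun k _ => by push_cast; ring
      _ = _ := by
        rw [Finset.sum_add_distrib, ← Finset.mul_sum, ← Finset.mul_sum, ih, h0]
        push_cast
        ring

theorem sum_choose_mul_sub_two_mul_pow_four (N : ℕ) :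
    ∑ k ∈ Finset.range (N + 1), (N.choose k : ℚ) * ((N : ℚ) - 2 * k) ^ 4
      = (3 * (N : ℚ) ^ 2 - 2 * N) * 2 ^ N := by
  induction N with
  | zero => simp
  | succ N ih =>
    have h0 : ∑ k ∈ Finset.range (N + 1), (N.choose k : ℚ) = 2 ^ N := by
      exact_mod_cast Nat.sum_range_choose N
    rw [sum_choose_succ_mul_eq]
    calc _ = ∑ k ∈ Finset.range (N + 1),
          (2 * ((N.choose k : ℚ) * ((N : ℚ) - 2 * k) ^ 4)
            + 12 * ((N.choose k : ℚ) * ((N : ℚ) - 2 * k) ^ 2) + 2 * (N.choose k : ℚ)) :=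
          Finset.sum_congr rfl fun k _ => by push_cast; ring
      _ = _ := by
        rw [Finset.sum_add_distrib, Finset.sum_add_distrib, ← Finset.mul_sum, ← Finset.mul_sum,
          ← Finset.mul_sum, ih, h0, sum_choose_mul_sub_two_mul_sq]
        push_cast
        ring

/-- A sum over `0, …, n` of terms symmetric under `p ↦ n - p` is twice its lower half, if the
middle term vanishes. -/
theorem sum_range_succ_eq_two_mul_of_symm {R : Type*} [CommSemiring R] (F : ℕ → R) (n : ℕ)
    (hsymm : ∀ p ≤ n, F (n - p) = F p) (hmid : ∀ p, 2 * p = n → F p = 0) :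
    ∑ p ∈ Finset.range (n + 1), F p
      = 2 * ∑ p ∈ Finset.range (n + 1) with 2 * p < n, F p := by
  have hupper : ∑ p ∈ Finset.range (n + 1) with ¬ 2 * p < n, F p
      = ∑ p ∈ Finset.range (n + 1) with n < 2 * p, F p := by
    symm
    refine Finset.sum_subset (fun p => ?_) fun p hp hp' => hmid p ?_
    · simp only [Finset.mem_filter, Finset.mem_range]
      omega
    · simp only [Finset.mem_filter, Finset.mem_range] at hp hp'
      omega
  have hreflect : ∑ p ∈ Finset.range (n + 1) with n < 2 * p, F p
      = ∑ p ∈ Finset.range (n + 1) with 2 * p < n, F p := by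
    refine Finset.sum_bij' (fun p _ => n - p) (fun p _ => n - p) ?_ ?_ ?_ ?_ ?_ <;>
      intro p hp <;> simp only [Finset.mem_filter, Finset.mem_range] at hp ⊢
    iterate 4 omega
    exact (hsymm p (by omega)).symm
  rw [← Finset.sum_filter_add_sum_filter_not _ (fun p => 2 * p < n), hupper, hreflect, two_mul]

theorem choose_succ_div_eq {n p : ℕ} (hp : p ≤ n) :
    (n.choose (p + 1) : ℚ) / ((n : ℚ) - p + 1)
      = ((n : ℚ) - p) * ((n + 2).choose (p + 1) : ℚ) / ((n + 1) * (n + 2)) := by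
  obtain ⟨m, rfl⟩ := Nat.exists_eq_add_of_le hp
  have h1 := Nat.choose_mul_succ_eq (p + m) (p + 1)
  have h2 := Nat.choose_mul_succ_eq (p + m + 1) (p + 1)
  rw [show p + m + 1 - (p + 1) = m by omega] at h1
  rw [show p + m + 1 + 1 - (p + 1) = m + 1 by omega] at h2
  replace h1 := congrArg (Nat.cast : ℕ → ℚ) h1
  replace h2 := congrArg (Nat.cast : ℕ → ℚ) h2
  push_cast at h1 h2 ⊢
  rw [show (p : ℚ) + m - p = m by ring,
    div_eq_div_iff (by positivity) (by positivity)]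
  linear_combination ((p : ℚ) + m + 2) * h1 + (m : ℚ) * h2

theorem sum_choose_add_two_mul_eq (n : ℕ) :
    ∑ p ∈ Finset.range (n + 1),
        ((n + 2).choose (p + 1) : ℚ) * ((p : ℚ) * (n - p) * ((n : ℚ) - 2 * p) ^ 2)
      = (n + 1) * (n + 2) * (((n : ℚ) - 4) * 2 ^ n + 2 * (n + 2)) := by
  have hfull : ∑ k ∈ Finset.range (n + 3), ((n + 2).choose k : ℚ) *
      (((k : ℚ) - 1) * (n + 1 - k) * ((n : ℚ) + 2 - 2 * k) ^ 2)
      = (n + 1) * (n + 2) * (((n : ℚ) - 4) * 2 ^ n) := by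
    have h2 := sum_choose_mul_sub_two_mul_sq (n + 2)
    have h4 := sum_choose_mul_sub_two_mul_pow_four (n + 2)
    push_cast at h2 h4
    calc _ = ∑ k ∈ Finset.range (n + 3),
          ((n : ℚ) ^ 2 / 4 * (((n + 2).choose k : ℚ) * ((n : ℚ) + 2 - 2 * k) ^ 2)
            - 1 / 4 * (((n + 2).choose k : ℚ) * ((n : ℚ) + 2 - 2 * k) ^ 4)) :=
          Finset.sum_congr rfl fun k _ => by ring
      _ = _ := by
        rw [Finset.sum_sub_distrib, ← Finset.mul_sum, ← Finset.mul_sum, h2, h4]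
        ring
  rw [Finset.sum_range_succ, Finset.sum_range_succ'] at hfull
  have hshift : ∑ p ∈ Finset.range (n + 1),
        ((n + 2).choose (p + 1) : ℚ) * ((p : ℚ) * (n - p) * ((n : ℚ) - 2 * p) ^ 2)
      = ∑ p ∈ Finset.range (n + 1), ((n + 2).choose (p + 1) : ℚ) *
        ((((p + 1 : ℕ) : ℚ) - 1) * (n + 1 - (p + 1 : ℕ)) * ((n : ℚ) + 2 - 2 * (p + 1 : ℕ)) ^ 2) :=
    Finset.sum_congr rfl fun p _ => by push_cast; ring
  rw [hshift]
  simp only [Nat.choose_self, Nat.choose_zero_right] at hfull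
  push_cast at hfull ⊢
  linear_combination hfull

/-- For every `n ≥ 1`, the identity
`Σ_{p=1}^{⌊(n−1)/2⌋} C(n,p+1)·p·(n−2p)²/(n−p+1) = (n−4)·2^{n−1} + n + 2` holds in `ℚ`.
This computes `Σ (q+1)·d_{(p+q,p,1)}` over all partitions `(p+q,p,1)` of `n`. -/
theorem three_row_degree_sum (n : ℕ) (hn : 1 ≤ n) :
    ∑ p ∈ Finset.Icc 1 ((n - 1) / 2),
        (n.choose (p + 1) : ℚ) * (p : ℚ) * ((n : ℚ) - 2 * p) ^ 2 / ((n : ℚ) - p + 1)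
      = ((n : ℚ) - 4) * 2 ^ (n - 1) + (n : ℚ) + 2 := by
  set F : ℕ → ℚ := fun p =>
    ((n + 2).choose (p + 1) : ℚ) * ((p : ℚ) * (n - p) * ((n : ℚ) - 2 * p) ^ 2) with hF
  have hterm : ∀ p ∈ Finset.Icc 1 ((n - 1) / 2),
      (n.choose (p + 1) : ℚ) * (p : ℚ) * ((n : ℚ) - 2 * p) ^ 2 / ((n : ℚ) - p + 1)
        = F p / ((n + 1) * (n + 2)) := by
    intro p hp
    rw [Finset.mem_Icc] at hp
    have h := choose_succ_div_eq (n := n) (p := p) (by omega)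
    calc _ = (n.choose (p + 1) : ℚ) / ((n : ℚ) - p + 1) * (p * ((n : ℚ) - 2 * p) ^ 2) := by ring
      _ = _ := by rw [h]; ring
  have hsymm : ∀ p ≤ n, F (n - p) = F p := by
    intro p hp
    have hc : (n + 2).choose (n - p + 1) = (n + 2).choose (p + 1) :=
      Nat.choose_symm_of_eq_add (by omega)
    simp only [hF, hc, Nat.cast_sub hp]
    ring
  have hmid : ∀ p, 2 * p = n → F p = 0 := by
    rintro p rfl
    simp [hF]
  have hhalf : ∑ p ∈ Finset.Icc 1 ((n - 1) / 2), F p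
      = ∑ p ∈ Finset.range (n + 1) with 2 * p < n, F p := by
    refine Finset.sum_subset (fun p => ?_) fun p hp hp' => ?_
    · simp only [Finset.mem_filter, Finset.mem_range, Finset.mem_Icc]
      omega
    · simp only [Finset.mem_filter, Finset.mem_range, Finset.mem_Icc] at hp hp'
      obtain rfl : p = 0 := by omega
      simp [hF]
  have hsum := sum_range_succ_eq_two_mul_of_symm F n hsymm hmid
  rw [sum_choose_add_two_mul_eq, ← hhalf] at hsum
  rw [Finset.sum_congr rfl hterm, ← Finset.sum_div, div_eq_iff (by positivity)]
  have hpow : (2 : ℚ) ^ n = 2 * 2 ^ (n - 1) := by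
    rw [← pow_succ', Nat.sub_add_cancel hn]
  rw [hpow] at hsum
  linear_combination -hsum / 2
end
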